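/- Let n be a positive integer and let G be a graph cospectral with the friendship graph F_n. If G is disconnected and G is the disjoint union of m copies of K_2 and a connected graph G_1 (m ≥ 1), then m ≤ ((2n+1)·λ_max − 6n)/(−2·λ_min), where λ_max = (1+√(1+8n))/2 and λ_min = (1−√(1+8n))/2 are the largest and smallest adjacency eigenvalues of F_n. -/

import Mathlib

open Polynomial

/-- The adjacency matrix of a simple graph, with entries in `R`. -/
noncomputable def adjMat (R : Type*) [Zero R] [One R] {V : Type*} [Fintype V]
    (G : SimpleGraph V) : Matrix V V R :=
  letI := Classical.decRel G.Adj
  G.adjMatrix R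

/-- The friendship graph `F n`: `n` triangles glued at the common vertex `none`. -/
def friendshipGraph (n : ℕ) : SimpleGraph (Option (Fin n × Bool)) :=
  SimpleGraph.fromRel (fun u v =>
    u = none ∨ ∃ i : Fin n, u = some (i, true) ∧ v = some (i, false))

/-- Two finite graphs are cospectral if their real adjacency matrices have the same
characteristic polynomial. -/
def Cospectral {V W : Type*} [Fintype V] [Fintype W] [DecidableEq V] [DecidableEq W]
    (G : SimpleGraph V) (H : SimpleGraph W) : Prop :=
  (adjMat ℝ G).charpoly = (adjMat ℝ H).charpoly

/-- `m` disjoint copies of `K₂`. -/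
def copiesK2 (m : ℕ) : SimpleGraph (Fin m × Bool) :=
  SimpleGraph.fromRel (fun u v => u.1 = v.1 ∧ u.2 = true ∧ v.2 = false)

open Matrix

/-- Real symmetric matrices with the same characteristic polynomial are orthogonally similar. -/
theorem Matrix.IsHermitian.exists_conjStarAlgAut_eq {ι : Type*} [Fintype ι] [DecidableEq ι]
    {A B : Matrix ι ι ℝ} (hA : A.IsHermitian) (hB : B.IsHermitian)
    (h : A.charpoly = B.charpoly) :
    ∃ U : unitary (Matrix ι ι ℝ), A = Unitary.conjStarAlgAut ℝ _ U B := by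
  refine ⟨hA.eigenvectorUnitary * star hB.eigenvectorUnitary, ?_⟩
  rw [map_mul, StarAlgEquiv.mul_apply, hB.conjStarAlgAut_star_eigenvectorUnitary,
    ← (hA.eigenvalues_eq_eigenvalues_iff hB).2 h]
  exact hA.spectral_theorem

theorem Matrix.card_eq_of_charpoly_eq {ι κ : Type*} [Fintype ι] [DecidableEq ι]
    [Fintype κ] [DecidableEq κ] {A : Matrix ι ι ℝ} {B : Matrix κ κ ℝ}
    (h : A.charpoly = B.charpoly) : Fintype.card ι = Fintype.card κ := by
  rw [← A.charpoly_natDegree_eq_dim, h, B.charpoly_natDegree_eq_dim]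

theorem Matrix.IsHermitian.trace_mul_self_eq_of_charpoly_eq {ι κ : Type*}
    [Fintype ι] [DecidableEq ι] [Fintype κ] [DecidableEq κ]
    {A : Matrix ι ι ℝ} {B : Matrix κ κ ℝ} (hA : A.IsHermitian) (hB : B.IsHermitian)
    (h : A.charpoly = B.charpoly) : (A * A).trace = (B * B).trace := by
  have e : κ ≃ ι := Fintype.equivOfCardEq (card_eq_of_charpoly_eq h).symm
  obtain ⟨U, hU⟩ := hA.exists_conjStarAlgAut_eq (hB.submatrix e.symm)
    (h.trans (charpoly_reindex e B).symm)
  rw [hU, ← map_mul, Unitary.conjStarAlgAut_apply, Matrix.trace_mul_cycle,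
    Unitary.coe_star_mul_self, one_mul, submatrix_mul_equiv]
  exact e.symm.sum_comp fun i => (B * B) i i

theorem Matrix.IsHermitian.posSemidef_smul_one_sub_of_charpoly_eq {ι κ : Type*}
    [Fintype ι] [DecidableEq ι] [Fintype κ] [DecidableEq κ]
    {A : Matrix ι ι ℝ} {B : Matrix κ κ ℝ} (hA : A.IsHermitian) (hB : B.IsHermitian)
    (h : A.charpoly = B.charpoly) {c : ℝ} (hc : (c • (1 : Matrix κ κ ℝ) - B).PosSemidef) :
    (c • (1 : Matrix ι ι ℝ) - A).PosSemidef := by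
  have e : κ ≃ ι := Fintype.equivOfCardEq (card_eq_of_charpoly_eq h).symm
  obtain ⟨U, hU⟩ := hA.exists_conjStarAlgAut_eq (hB.submatrix e.symm)
    (h.trans (charpoly_reindex e B).symm)
  have key : c • (1 : Matrix ι ι ℝ) - A =
      Unitary.conjStarAlgAut ℝ _ U ((c • (1 : Matrix κ κ ℝ) - B).submatrix e.symm e.symm) := by
    rw [hU, submatrix_sub, Pi.sub_apply, Pi.sub_apply, submatrix_smul, Pi.smul_apply, Pi.smul_apply,
      submatrix_one_equiv, map_sub, map_smul, map_one]
  rw [key, Unitary.conjStarAlgAut_apply]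
  exact (hc.submatrix e.symm).mul_mul_conjTranspose_same _

theorem adjMat_apply {V : Type*} [Fintype V] (G : SimpleGraph V) (u v : V) [Decidable (G.Adj u v)] :
    adjMat ℝ G u v = if G.Adj u v then 1 else 0 := by
  rw [adjMat, SimpleGraph.adjMatrix_apply]
  congr

theorem isHermitian_adjMat {V : Type*} [Fintype V] (G : SimpleGraph V) :
    (adjMat ℝ G).IsHermitian := by
  classical
  ext u v
  simp [adjMat_apply, G.adj_comm]

theorem trace_adjMat_mul_self {V : Type*} [Fintype V] (G : SimpleGraph V) :
    (adjMat ℝ G * adjMat ℝ G).trace = ∑ u, ∑ v, adjMat ℝ G u v := by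
  classical
  simp only [Matrix.trace, Matrix.diag, Matrix.mul_apply]
  refine Finset.sum_congr rfl fun u _ => Finset.sum_congr rfl fun v _ => ?_
  simp [adjMat_apply, G.adj_comm v u]

theorem friendshipGraph_adj_none_some {n : ℕ} (p : Fin n × Bool) :
    (friendshipGraph n).Adj none (some p) := by
  simp [friendshipGraph]

theorem friendshipGraph_adj_some_some {n : ℕ} (p q : Fin n × Bool) :
    (friendshipGraph n).Adj (some p) (some q) ↔ p.1 = q.1 ∧ p.2 ≠ q.2 := by
  obtain ⟨i, a⟩ := p
  obtain ⟨j, b⟩ := q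
  cases a <;> cases b <;> simp [friendshipGraph, eq_comm (a := j)]

theorem sum_adjMat_friendshipGraph (n : ℕ)
    (f : Option (Fin n × Bool) → ℝ) :
    ∑ u, ∑ v, f u * adjMat ℝ (friendshipGraph n) u v * f v =
      ∑ i, (2 * f none * (f (some (i, true)) + f (some (i, false))) +
        2 * f (some (i, true)) * f (some (i, false))) := by
  classical
  simp only [Fintype.sum_option, adjMat_apply, friendshipGraph_adj_none_some,
    (friendshipGraph_adj_none_some _).symm, friendshipGraph_adj_some_some, SimpleGraph.irrefl,
    Fintype.sum_prod_type, Fintype.sum_bool]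
  simp only [ne_eq, Bool.true_eq_false, Bool.false_eq_true, not_true_eq_false, not_false_eq_true,
    and_true, and_false, if_true, if_false, mul_one, mul_zero, zero_mul, mul_ite, ite_mul,
    Finset.sum_ite_eq, Finset.mem_univ, zero_add, add_zero, ← Finset.sum_add_distrib]
  exact Finset.sum_congr rfl fun i _ => by ring

theorem posSemidef_friendshipGraph {n : ℕ} (hn : 0 < n) {c : ℝ} (hc : 1 < c)
    (hcn : c * (c - 1) = 2 * n) :
    (c • (1 : Matrix (Option (Fin n × Bool)) (Option (Fin n × Bool)) ℝ) -
      adjMat ℝ (friendshipGraph n)).PosSemidef := by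
  have hn' : (0 : ℝ) < n := by exact_mod_cast hn
  refine .of_dotProduct_mulVec_nonneg
    ((isHermitian_one.smul (IsSelfAdjoint.all c)).sub (isHermitian_adjMat _)) fun f => ?_
  have hA : f ⬝ᵥ adjMat ℝ (friendshipGraph n) *ᵥ f =
      ∑ u, ∑ v, f u * adjMat ℝ (friendshipGraph n) u v * f v := by
    simp only [dotProduct, mulVec, Finset.mul_sum, mul_assoc]
  have hs : f ⬝ᵥ f = ∑ i : Fin n, (f none ^ 2 / n + f (some (i, true)) ^ 2 +
      f (some (i, false)) ^ 2) := by
    simp only [dotProduct, Fintype.sum_option, Fintype.sum_prod_type, Fintype.sum_bool,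
      Finset.sum_add_distrib]
    simp
    field_simp
    ring
  rw [star_trivial, sub_mulVec, dotProduct_sub, smul_mulVec, one_mulVec, dotProduct_smul, hA, hs,
    sum_adjMat_friendshipGraph, smul_eq_mul, Finset.mul_sum, ← Finset.sum_sub_distrib]
  refine Finset.sum_nonneg fun i _ => ?_
  generalize f none = z, f (some (i, true)) = x, f (some (i, false)) = y
  have hz : c * (z ^ 2 / n) = 2 * z ^ 2 / (c - 1) := by
    have : c - 1 ≠ 0 := by linarith
    field_simp
    linear_combination z ^ 2 * hcn
  have : 0 < c - 1 := by linarith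
  have key : c * (z ^ 2 / n + x ^ 2 + y ^ 2) - (2 * z * (x + y) + 2 * x * y) =
      ((c - 1) * (x + y) - 2 * z) ^ 2 / (2 * (c - 1)) + (c + 1) / 2 * (x - y) ^ 2 := by
    rw [mul_add, mul_add, hz]
    field_simp
    ring
  rw [key]
  positivity

theorem sum_adjMat_copiesK2 (m : ℕ) : ∑ p, ∑ q, adjMat ℝ (copiesK2 m) p q = 2 * m := by
  classical
  have h (p q : Fin m × Bool) : (copiesK2 m).Adj p q ↔ p.1 = q.1 ∧ p.2 ≠ q.2 := by
    obtain ⟨i, a⟩ := p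
    obtain ⟨j, b⟩ := q
    cases a <;> cases b <;> simp [copiesK2, eq_comm (a := j)]
  simp [adjMat_apply, h, Fintype.sum_prod_type, ite_and]
  ring

theorem sum_adjMat_sum {V W : Type*} [Fintype V] [Fintype W] (G : SimpleGraph V)
    (H : SimpleGraph W) (f : V ⊕ W → ℝ) :
    ∑ u, ∑ v, f u * adjMat ℝ (G ⊕g H) u v * f v =
      (∑ u, ∑ v, f (.inl u) * adjMat ℝ G u v * f (.inl v)) +
        ∑ u, ∑ v, f (.inr u) * adjMat ℝ H u v * f (.inr v) := by
  classical
  simp [Fintype.sum_sum_type, adjMat_apply]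

theorem sum_adjMat_iso {V W : Type*} [Fintype V] [Fintype W] {G : SimpleGraph V}
    {H : SimpleGraph W} (e : G ≃g H) (f : W → ℝ) :
    ∑ u, ∑ v, f (e u) * adjMat ℝ G u v * f (e v) = ∑ u, ∑ v, f u * adjMat ℝ H u v * f v := by
  classical
  rw [← e.toEquiv.sum_comp]
  refine Finset.sum_congr rfl fun u _ => ?_
  rw [← e.toEquiv.sum_comp]
  refine Finset.sum_congr rfl fun v _ => ?_
  change f (e u) * _ * f (e v) = f (e u) * _ * f (e v)
  have h : H.Adj (e.toEquiv u) (e.toEquiv v) ↔ G.Adj u v := e.map_adj_iff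
  simp only [adjMat_apply, h]

/-- if `G` is cospectral with the friendship graph `F n`, is disconnected,
and is the disjoint union of `m ≥ 1` copies of `K₂` and a connected graph `G₁`, then
`m ≤ ((2n+1)·λmax − 6n)/(−2·λmin)` where `λmax = (1+√(1+8n))/2` and
`λmin = (1−√(1+8n))/2`. -/
theorem num_K2_components_bound
    {V W : Type*} [Fintype V] [DecidableEq V] [Fintype W]
    (n : ℕ) (hn : 0 < n) (G : SimpleGraph V)
    (hG : Cospectral G (friendshipGraph n))
    (hdisc : ¬ G.Connected)
    (m : ℕ) (hm : 1 ≤ m) (G₁ : SimpleGraph W) (hG₁ : G₁.Connected)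
    (hiso : Nonempty (G ≃g (G₁ ⊕g copiesK2 m))) :
    (m : ℝ) ≤ ((2 * n + 1) * ((1 + Real.sqrt (1 + 8 * (n : ℝ))) / 2) - 6 * n) /
      (-2 * ((1 - Real.sqrt (1 + 8 * (n : ℝ))) / 2)) := by
  classical
  obtain ⟨e⟩ := hiso
  have hn' : (1 : ℝ) ≤ n := by exact_mod_cast hn
  set s := Real.sqrt (1 + 8 * (n : ℝ))
  have hs2 : s ^ 2 = 1 + 8 * n := Real.sq_sqrt (by positivity)
  have hs1 : 1 < s := by
    have : 0 ≤ s := Real.sqrt_nonneg _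
    nlinarith
  have hcard : (Fintype.card W : ℝ) + 2 * m = 2 * n + 1 := by
    have h₁ := card_eq_of_charpoly_eq hG
    have h₂ := Fintype.card_congr e.toEquiv
    simp at h₁ h₂
    have : Fintype.card W + 2 * m = 2 * n + 1 := by omega
    exact_mod_cast this
  have hedges : (∑ u, ∑ v, adjMat ℝ G₁ u v) + 2 * m = 6 * n := by
    have h := (isHermitian_adjMat G).trace_mul_self_eq_of_charpoly_eq
      (isHermitian_adjMat (friendshipGraph n)) hG
    have hF := sum_adjMat_friendshipGraph n fun _ => 1
    have hV := (sum_adjMat_iso e fun _ => 1).trans (sum_adjMat_sum G₁ (copiesK2 m) fun _ => 1)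
    simp only [one_mul, mul_one, sum_adjMat_copiesK2] at hF hV
    rw [trace_adjMat_mul_self, trace_adjMat_mul_self, hF, hV] at h
    rw [h]
    simp
    ring
  let f : W ⊕ (Fin m × Bool) → ℝ := Sum.elim 1 0
  have hpos := ((isHermitian_adjMat G).posSemidef_smul_one_sub_of_charpoly_eq
    (isHermitian_adjMat _) hG (posSemidef_friendshipGraph hn (c := (1 + s) / 2) (by linarith)
      (by linear_combination hs2 / 4))).dotProduct_mulVec_nonneg (f ∘ e)
  have hnorm : (f ∘ e) ⬝ᵥ (f ∘ e) = Fintype.card W := by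
    refine (e.toEquiv.sum_comp fun u => f u * f u).trans ?_
    simp [f]
  have hquad : (f ∘ e) ⬝ᵥ adjMat ℝ G *ᵥ (f ∘ e) = ∑ u, ∑ v, adjMat ℝ G₁ u v := by
    have h := (sum_adjMat_iso e f).trans (sum_adjMat_sum G₁ (copiesK2 m) f)
    simp only [f, Sum.elim_inl, Sum.elim_inr, Pi.one_apply, Pi.zero_apply, one_mul, mul_one,
      mul_zero, Finset.sum_const_zero, add_zero] at h
    rw [← h]
    simp only [f, dotProduct, mulVec, Finset.mul_sum, mul_assoc, Function.comp_apply]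
  rw [star_trivial, sub_mulVec, dotProduct_sub, smul_mulVec, one_mulVec, dotProduct_smul, hnorm,
    hquad, smul_eq_mul] at hpos
  rw [le_div_iff₀ (by linarith)]
  have h₁ : (Fintype.card W : ℝ) = 2 * n + 1 - 2 * m := by linarith
  rw [h₁] at hpos
  linarith
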